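/- arXiv:0810.0731 — 2 statements merged into one kernel-verified Lean document; each statement's English description precedes it below -/
import Mathlib

section
/- Let t > 0 and let z₀ : ℝ → ℂ be C¹ in a neighborhood of σ₀ with 1 − ½ z₀'(σ₀) t ≠ 0. If W is holomorphic in a neighborhood of X(σ₀,t) := e^{i(σ₀ − ½ z₀(σ₀) t)} and satisfies W(e^{i(σ − ½ z₀(σ) t)}) = z₀(σ) for all σ near σ₀, then z₀ is C^∞ in a neighborhood of σ₀. -/
open Filter Set Function
open scoped Real Topology

noncomputable section

/-- **Smoothness propagates back along complex characteristics.** Let `t > 0`, let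
`z₀ : ℝ → ℂ` be `C¹` near `σ₀` with `1 - ½ z₀'(σ₀) t ≠ 0`. If `W` is holomorphic in a
neighborhood of `X(σ₀,t) = e^{i(σ₀ - ½ z₀(σ₀) t)}` and satisfies
`W(e^{i(σ - ½ z₀(σ) t)}) = z₀(σ)` for all `σ` near `σ₀`, then `z₀` is `C^∞` in a
neighborhood of `σ₀`. -/
theorem smoothness_from_characteristics
    (t : ℝ) (ht : 0 < t) (σ₀ : ℝ) (z₀ : ℝ → ℂ)
    (hz₀ : ContDiffAt ℝ 1 z₀ σ₀)
    (hnd : 1 - (1 / 2) * deriv z₀ σ₀ * (t : ℂ) ≠ 0)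
    (W : ℂ → ℂ)
    (hW : ∃ V ∈ 𝓝 (Complex.exp (Complex.I * ((σ₀ : ℂ) - (1 / 2) * z₀ σ₀ * (t : ℂ)))),
      DifferentiableOn ℂ W V)
    (hcons : ∀ᶠ σ : ℝ in 𝓝 σ₀,
      W (Complex.exp (Complex.I * ((σ : ℂ) - (1 / 2) * z₀ σ * (t : ℂ)))) = z₀ σ) :
    ContDiffAt ℝ (⊤ : ℕ∞) z₀ σ₀ := by
  obtain ⟨V, hV, hWV⟩ := hW
  have hdz : HasDerivAt z₀ (deriv z₀ σ₀) σ₀ :=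
    (hz₀.differentiableAt one_ne_zero).hasDerivAt
  set ζ : ℝ → ℂ := fun σ => (σ : ℂ) - (1 / 2) * z₀ σ * (t : ℂ) with hζ
  have hζd : HasDerivAt ζ (1 - (1 / 2) * deriv z₀ σ₀ * (t : ℂ)) σ₀ :=
    (Complex.ofRealCLM.hasDerivAt (x := σ₀)).sub ((hdz.const_mul (1 / 2)).mul_const (t : ℂ))
  have hWa : ContDiffAt ℂ (⊤ : ℕ∞) W (Complex.exp (Complex.I * ζ σ₀)) :=
    (hWV.analyticAt hV).contDiffAt
  have hWe : ContDiffAt ℂ (⊤ : ℕ∞) (fun w => W (Complex.exp (Complex.I * w))) (ζ σ₀) :=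
    hWa.comp (ζ σ₀) (contDiffAt_const.mul contDiffAt_id).cexp
  set h : ℂ → ℂ := fun w => w + (t / 2 : ℂ) * W (Complex.exp (Complex.I * w)) with hh
  have hhc : ContDiffAt ℂ (⊤ : ℕ∞) h (ζ σ₀) :=
    contDiffAt_id.add (contDiffAt_const.mul hWe)
  have hinv : ∀ᶠ σ : ℝ in 𝓝 σ₀, h (ζ σ) = σ := by
    filter_upwards [hcons] with σ hσ
    simp only [hh, hζ, hσ]
    ring
  have hhs : HasStrictDerivAt h (deriv h (ζ σ₀)) (ζ σ₀) := hhc.hasStrictDerivAt (by simp)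
  have hne : deriv h (ζ σ₀) ≠ 0 := by
    have hcomp := hhs.hasDerivAt.comp_of_eq σ₀ hζd rfl
    have hid := (Complex.ofRealCLM.hasDerivAt (x := σ₀)).congr_of_eventuallyEq hinv
    have := hcomp.unique hid
    intro h0
    simp [h0] at this
  have hhf := hhs.hasStrictFDerivAt_equiv hne
  have hleft := hζd.continuousAt.eventually hhf.eventually_left_inverse
  have hloc : ContDiffAt ℂ (⊤ : ℕ∞) (hhf.localInverse h _ _) (h (ζ σ₀)) :=
    hhc.to_localInverse hhf.hasFDerivAt (by simp)
  rw [hinv.self_of_nhds] at hloc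
  have hζc : ContDiffAt ℝ (⊤ : ℕ∞) ζ σ₀ := by
    refine ((hloc.restrict_scalars ℝ).comp σ₀ Complex.ofRealCLM.contDiff.contDiffAt)
      |>.congr_of_eventuallyEq ?_
    filter_upwards [hleft, hinv] with σ h1 h2
    rw [h2] at h1
    exact h1.symm
  refine ((hWe.restrict_scalars ℝ).comp σ₀ hζc).congr_of_eventuallyEq ?_
  filter_upwards [hcons] with σ hσ
  exact hσ.symm
end
end

section
/- Let z = (z₁,z₂) : ℝ → ℝ² be a continuous curve with z(α+2π) = z(α) + (2π,0) and z₂ bounded, and let ϖ be a continuous 2π-periodic function. For x = (x₁,x₂) ∈ ℝ² off the curve define v(x) = −(1/4π) ∫_{-π}^{π} ϖ(β) ( tanh((x₂−z₂(β))/2)(1+tan²((x₁−z₁(β))/2)) / (tan²((x₁−z₁(β))/2)+tanh²((x₂−z₂(β))/2)) , tan((x₁−z₁(β))/2)(tanh²((x₂−z₂(β))/2)−1) / (tan²((x₁−z₁(β))/2)+tanh²((x₂−z₂(β))/2)) ) dβ. Then lim_{x₂→+∞} v(x) = −(1/4π)(∫_{-π}^{π} ϖ(β) dβ)·(1,0)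 and lim_{x₂→−∞} v(x) = +(1/4π)(∫_{-π}^{π} ϖ(β) dβ)·(1,0), uniformly in x₁. In particular, the two limits agree if and only if ∫_{-π}^{π} ϖ = 0. -/
open MeasureTheory Filter Set Function
open scoped Real Topology

noncomputable section

/-- The velocity field generated by a horizontally `2π`-periodic vortex sheet (obtained from
the Biot–Savart law by summing over the periods). -/
def periodicSheetVelocity (z : ℝ → ℝ × ℝ) (ϖ : ℝ → ℝ) (x : ℝ × ℝ) : ℝ × ℝ :=
  (-(1 / (4 * π))) •
    ∫ β in Ioo (-π) π, ϖ β •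
      ((Real.tanh ((x.2 - (z β).2) / 2) * (1 + Real.tan ((x.1 - (z β).1) / 2) ^ 2) /
          (Real.tan ((x.1 - (z β).1) / 2) ^ 2 + Real.tanh ((x.2 - (z β).2) / 2) ^ 2),
        Real.tan ((x.1 - (z β).1) / 2) * (Real.tanh ((x.2 - (z β).2) / 2) ^ 2 - 1) /
          (Real.tan ((x.1 - (z β).1) / 2) ^ 2 + Real.tanh ((x.2 - (z β).2) / 2) ^ 2)) : ℝ × ℝ)

/-- One period of the periodic Biot–Savart kernel, at horizontal and vertical displacements
`p` and `q`. -/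
def periodicBiotSavartKernel (p q : ℝ) : ℝ × ℝ :=
  (Real.tanh (q / 2) * (1 + Real.tan (p / 2) ^ 2) /
      (Real.tan (p / 2) ^ 2 + Real.tanh (q / 2) ^ 2),
    Real.tan (p / 2) * (Real.tanh (q / 2) ^ 2 - 1) /
      (Real.tan (p / 2) ^ 2 + Real.tanh (q / 2) ^ 2))

theorem tendsto_tanh_atTop : Tendsto Real.tanh atTop (𝓝 1) := by
  have h : Tendsto (fun y : ℝ => Real.exp (-(2 * y))) atTop (𝓝 0) :=
    Real.tendsto_exp_neg_atTop_nhds_zero.comp (tendsto_id.const_mul_atTop two_pos)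
  have h' : Tendsto (fun y : ℝ => (1 - Real.exp (-(2 * y))) / (1 + Real.exp (-(2 * y))))
      atTop (𝓝 ((1 - 0) / (1 + 0))) :=
    (h.const_sub 1).div (h.const_add 1) (by norm_num)
  simp only [sub_zero, add_zero, div_one] at h'
  refine h'.congr fun y => ?_
  have e : Real.exp (-(2 * y)) = Real.exp (-y) * Real.exp (-y) := by
    rw [← Real.exp_add]; ring_nf
  have e1 : Real.exp y * Real.exp (-y) = 1 := by rw [← Real.exp_add]; simp
  have hp := Real.exp_pos y
  have hn := Real.exp_pos (-y)
  rw [Real.tanh_eq, e, div_eq_div_iff (by positivity) (by positivity)]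
  linear_combination (-2 * Real.exp (-y)) * e1

theorem abs_kernel_fst_sub_le {T h σ δ : ℝ} (hσ : σ ^ 2 = 1) (hpos : 0 < σ * h)
    (hle : σ * h ≤ 1) (hδ : 1 - σ * h ≤ δ * (σ * h)) :
    |h * (1 + T ^ 2) / (T ^ 2 + h ^ 2) - σ| ≤ δ := by
  obtain ⟨a, ha⟩ : ∃ a, a = σ * h := ⟨_, rfl⟩
  have hh : h = σ * a := by rw [ha]; linear_combination (-h) * hσ
  rw [← ha] at hpos hle hδ
  have hsq : h ^ 2 = a ^ 2 := by rw [hh]; linear_combination a ^ 2 * hσ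
  have hD : 0 < T ^ 2 + a ^ 2 := by positivity
  have hσ1 : |σ| = 1 := by
    rw [← sq_eq_sq₀ (abs_nonneg _) zero_le_one, sq_abs, hσ, one_pow]
  have e : h * (1 + T ^ 2) / (T ^ 2 + h ^ 2) - σ
      = σ * ((1 - a) * (a - T ^ 2) / (T ^ 2 + a ^ 2)) := by
    rw [hsq, hh]; field_simp; ring
  have hδ0 : 0 ≤ δ := nonneg_of_mul_nonneg_left ((sub_nonneg.2 hle).trans hδ) hpos
  have hT : |a - T ^ 2| * a ≤ T ^ 2 + a ^ 2 := by
    rw [← abs_of_pos hpos, ← abs_mul, abs_of_pos hpos, abs_le]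
    constructor <;> nlinarith [sq_nonneg T]
  rw [e, abs_mul, hσ1, one_mul, abs_div, abs_of_pos hD, div_le_iff₀ hD, abs_mul,
    abs_of_nonneg (sub_nonneg.2 hle)]
  calc (1 - a) * |a - T ^ 2| ≤ δ * a * |a - T ^ 2| := by gcongr
    _ = δ * (|a - T ^ 2| * a) := by ring
    _ ≤ δ * (T ^ 2 + a ^ 2) := by gcongr

theorem abs_kernel_snd_le {T h σ δ : ℝ} (hσ : σ ^ 2 = 1) (hpos : 0 < σ * h)
    (hle : σ * h ≤ 1) (hδ : 1 - σ * h ≤ δ * (σ * h)) :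
    |T * (h ^ 2 - 1) / (T ^ 2 + h ^ 2)| ≤ δ := by
  obtain ⟨a, ha⟩ : ∃ a, a = σ * h := ⟨_, rfl⟩
  have hsq : h ^ 2 = a ^ 2 := by rw [ha]; linear_combination (-h ^ 2) * hσ
  rw [← ha] at hpos hle hδ
  rw [hsq]
  have hD : 0 < T ^ 2 + a ^ 2 := by positivity
  have hδ0 : 0 ≤ δ := nonneg_of_mul_nonneg_left ((sub_nonneg.2 hle).trans hδ) hpos
  have hT : 2 * (a * |T|) ≤ T ^ 2 + a ^ 2 := by
    nlinarith [sq_nonneg (|T| - a), sq_abs T]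
  have h1 : |a ^ 2 - 1| ≤ 2 * (δ * a) := by
    rw [abs_le]; constructor <;> nlinarith
  rw [abs_div, abs_of_pos hD, div_le_iff₀ hD, abs_mul]
  calc |T| * |a ^ 2 - 1| ≤ |T| * (2 * (δ * a)) := by gcongr
    _ = δ * (2 * (a * |T|)) := by ring
    _ ≤ δ * (T ^ 2 + a ^ 2) := by gcongr

theorem tanh_mul_of_sq_eq_one {σ : ℝ} (hσ : σ ^ 2 = 1) (y : ℝ) :
    Real.tanh (σ * y) = σ * Real.tanh y := by
  rcases mul_self_eq_one_iff.1 ((sq σ).symm.trans hσ) with rfl | rfl <;> simp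

/-- Far above (`σ = 1`) or below (`σ = -1`) the sheet, the kernel is uniformly close to
`(σ, 0)`. -/
theorem exists_norm_periodicBiotSavartKernel_sub_le {σ δ : ℝ} (hσ : σ ^ 2 = 1) (hδ : 0 < δ) :
    ∃ N : ℝ, ∀ p q : ℝ, N < σ * q → ‖periodicBiotSavartKernel p q - (σ, 0)‖ ≤ δ := by
  have hr : 1 / (1 + δ) < 1 := by rw [div_lt_one (by positivity)]; linarith
  obtain ⟨N, hN⟩ := eventually_atTop.1 (tendsto_tanh_atTop.eventually_const_lt hr)
  refine ⟨2 * N, fun p q hq => ?_⟩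
  have h1 := hN (σ * (q / 2)) (by linarith)
  have h2 := Real.tanh_lt_one (σ * (q / 2))
  rw [tanh_mul_of_sq_eq_one hσ] at h1 h2
  have hpos : 0 < σ * Real.tanh (q / 2) := lt_trans (by positivity) h1
  rw [div_lt_iff₀ (by positivity)] at h1
  have h3 : 1 - σ * Real.tanh (q / 2) ≤ δ * (σ * Real.tanh (q / 2)) := by linarith
  rw [Prod.norm_def, max_le_iff]
  constructor
  · exact abs_kernel_fst_sub_le hσ hpos h2.le h3
  · simpa only [periodicBiotSavartKernel, Prod.snd_sub, sub_zero, Real.norm_eq_abs] using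
      abs_kernel_snd_le (T := Real.tan (p / 2)) hσ hpos h2.le h3

theorem measurable_periodicBiotSavartKernel :
    Measurable fun x : ℝ × ℝ => periodicBiotSavartKernel x.1 x.2 := by
  simp only [periodicBiotSavartKernel, Real.tan_eq_sin_div_cos, Real.tanh_eq_sinh_div_cosh]
  fun_prop

theorem exists_norm_periodicSheetVelocity_sub_lt {z : ℝ → ℝ × ℝ} {ϖ : ℝ → ℝ}
    (hz : Continuous z) (hzbdd : ∃ M : ℝ, ∀ α : ℝ, |(z α).2| ≤ M) (hϖ : Continuous ϖ)
    {σ : ℝ} (hσ : σ ^ 2 = 1) {ε : ℝ} (hε : 0 < ε) :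
    ∃ M : ℝ, ∀ x₁ x₂ : ℝ, M < σ * x₂ →
      ‖periodicSheetVelocity z ϖ (x₁, x₂) -
        ((-(σ / (4 * π))) * ∫ β in Ioo (-π) π, ϖ β, (0 : ℝ))‖ < ε := by
  obtain ⟨B, hB⟩ := hzbdd
  have hint : IntegrableOn ϖ (Ioo (-π) π) :=
    (hϖ.integrableOn_Icc (a := -π) (b := π)).mono_set Ioo_subset_Icc_self
  obtain ⟨C, hC⟩ : ∃ C, C = ∫ β in Ioo (-π) π, |ϖ β| := ⟨_, rfl⟩
  have hC0 : 0 ≤ C := hC ▸ integral_nonneg fun _ => abs_nonneg _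
  obtain ⟨δ, hδdef⟩ : ∃ δ, δ = ε / (C + 1) := ⟨_, rfl⟩
  have hδ : 0 < δ := by rw [hδdef]; positivity
  obtain ⟨N, hN⟩ := exists_norm_periodicBiotSavartKernel_sub_le hσ hδ
  refine ⟨N + B, fun x₁ x₂ hx => ?_⟩
  let K : ℝ → ℝ × ℝ := fun β => periodicBiotSavartKernel (x₁ - (z β).1) (x₂ - (z β).2)
  have hK : ∀ β, ‖ϖ β • (K β - (σ, 0))‖ ≤ δ * |ϖ β| := fun β => by
    have hσz : σ * (z β).2 ≤ B := by
      refine le_trans ?_ (hB β)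
      rcases mul_self_eq_one_iff.1 ((sq σ).symm.trans hσ) with rfl | rfl
      · simpa using le_abs_self _
      · simpa using neg_le_abs _
    rw [norm_smul, mul_comm, Real.norm_eq_abs]
    gcongr
    exact hN _ _ (by rw [mul_sub]; linarith)
  have hKm : Measurable K := measurable_periodicBiotSavartKernel.comp
    (f := fun β => (x₁ - (z β).1, x₂ - (z β).2)) (by fun_prop)
  have hbound : IntegrableOn (fun β => δ * |ϖ β|) (Ioo (-π) π) := hint.abs.const_mul δ
  have hdiff : IntegrableOn (fun β => ϖ β • (K β - (σ, 0))) (Ioo (-π) π) :=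
    Integrable.mono' hbound (hϖ.measurable.smul (hKm.sub_const _)).aestronglyMeasurable
      (Eventually.of_forall hK)
  have hconst : IntegrableOn (fun β => ϖ β • ((σ, 0) : ℝ × ℝ)) (Ioo (-π) π) :=
    hint.smul_const _
  have hsplit : periodicSheetVelocity z ϖ (x₁, x₂) -
      ((-(σ / (4 * π))) * ∫ β in Ioo (-π) π, ϖ β, (0 : ℝ)) =
      (-(1 / (4 * π))) • ∫ β in Ioo (-π) π, ϖ β • (K β - (σ, 0)) := by
    have hv : periodicSheetVelocity z ϖ (x₁, x₂) = (-(1 / (4 * π))) •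
        ∫ β in Ioo (-π) π, (ϖ β • (K β - (σ, 0)) + ϖ β • ((σ, 0) : ℝ × ℝ)) := by
      simp only [← smul_add, sub_add_cancel]
      rfl
    rw [hv, integral_add hdiff hconst, integral_smul_const, smul_add, add_sub_assoc,
      add_eq_left, sub_eq_zero]
    ext
    · simp only [Prod.smul_fst, smul_eq_mul]; ring
    · simp
  rw [hsplit, norm_smul, norm_neg, Real.norm_of_nonneg (by positivity)]
  have hI : ‖∫ β in Ioo (-π) π, ϖ β • (K β - (σ, 0))‖ ≤ δ * C := by
    rw [hC, ← integral_const_mul]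
    exact norm_integral_le_of_norm_le hbound (Eventually.of_forall hK)
  have hπ : 1 / (4 * π) ≤ 1 := by
    rw [div_le_one (by positivity)]; linarith [Real.pi_gt_three]
  calc 1 / (4 * π) * ‖∫ β in Ioo (-π) π, ϖ β • (K β - (σ, 0))‖ ≤ 1 * (δ * C) := by gcongr
    _ < δ * (C + 1) := by linarith
    _ = ε := by rw [hδdef]; field_simp

/-- **Behaviour at infinity of the periodic vortex-sheet velocity.**
`v → ∓(1/4π)(∫ϖ)(1,0)` as `x₂ → ±∞`, uniformly in `x₁`; in particular, the two limits
agree if and only if `∫ϖ = 0`. -/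
theorem periodicSheetVelocity_limits_at_infinity
    (z : ℝ → ℝ × ℝ) (ϖ : ℝ → ℝ)
    (hzcont : Continuous z)
    (hzper : ∀ α : ℝ, z (α + 2 * π) = z α + ((2 * π : ℝ), (0 : ℝ)))
    (hzbdd : ∃ M : ℝ, ∀ α : ℝ, |(z α).2| ≤ M)
    (hϖcont : Continuous ϖ) (hϖper : Function.Periodic ϖ (2 * π)) :
    (∀ ε > (0:ℝ), ∃ M : ℝ, ∀ x₁ x₂ : ℝ, M < x₂ →
      ‖periodicSheetVelocity z ϖ (x₁, x₂) -
        ((-(1 / (4 * π))) * ∫ β in Ioo (-π) π, ϖ β, (0:ℝ))‖ < ε) ∧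
    (∀ ε > (0:ℝ), ∃ M : ℝ, ∀ x₁ x₂ : ℝ, x₂ < -M →
      ‖periodicSheetVelocity z ϖ (x₁, x₂) -
        ((1 / (4 * π)) * ∫ β in Ioo (-π) π, ϖ β, (0:ℝ))‖ < ε) ∧
    ((((-(1 / (4 * π))) * ∫ β in Ioo (-π) π, ϖ β, (0:ℝ)) : ℝ × ℝ) =
        ((1 / (4 * π)) * ∫ β in Ioo (-π) π, ϖ β, (0:ℝ)) ↔
      (∫ β in Ioo (-π) π, ϖ β) = 0) := by
  refine ⟨fun ε hε => ?_, fun ε hε => ?_, ?_⟩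
  · simpa only [one_mul] using
      exists_norm_periodicSheetVelocity_sub_lt hzcont hzbdd hϖcont (σ := 1) (one_pow 2) hε
  · obtain ⟨M, hM⟩ := exists_norm_periodicSheetVelocity_sub_lt hzcont hzbdd hϖcont
      (σ := -1) (by norm_num) hε
    refine ⟨M, fun x₁ x₂ hx => ?_⟩
    simpa only [neg_div, neg_neg] using hM x₁ x₂ (by linarith)
  · rw [Prod.mk.injEq, and_iff_left rfl, neg_mul, neg_eq_self, mul_eq_zero,
      or_iff_right (by positivity)]
end
end
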